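/- A trapezoidal word w over {a,b} is right special (i.e., both wa and wb are trapezoidal) if and only if either (1) w is a suffix of some central word, or (2) w = p·x·u·x·y·u for some central word u, distinct letters x,y with {x,y} = {a,b}, and a word p such that π_{pxux} = π_{ux}. -/

import Mathlib

/-- The two-letter alphabet {a, b}. -/
inductive AB : Type
  | a : AB
  | b : AB
deriving DecidableEq, Repr

/-- A (finite) word over {a, b}. -/
abbrev Word := List AB

open AB

/-- `u` occurs in `w` at position `i`. -/
def OccursAt (u w : Word) (i : ℕ) : Prop :=
  i + u.length ≤ w.length ∧ (w.drop i).take u.length = u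

/-- `u` occurs exactly once in `w` (is unrepeated in `w`). -/
def OccursOnce (u w : Word) : Prop := ∃! i, OccursAt u w i

/-- `u` is a right special factor of `w`: both `ua` and `ub` are factors of `w`. -/
def IsRightSpecial (u w : Word) : Prop := (u ++ [a]) <:+: w ∧ (u ++ [b]) <:+: w

/-- `u` is a left special factor of `w`: both `au` and `bu` are factors of `w`. -/
def IsLeftSpecial (u w : Word) : Prop := ([a] ++ u) <:+: w ∧ ([b] ++ u) <:+: w

/-- `K w`: the length of the shortest unrepeated suffix of `w`. -/
noncomputable def Kp (w : Word) : ℕ := sInf {n | ∃ s : Word, s <:+ w ∧ s.length = n ∧ OccursOnce s w}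

/-- `H w`: the length of the shortest unrepeated prefix of `w`. -/
noncomputable def Hp (w : Word) : ℕ := sInf {n | ∃ p : Word, p <+: w ∧ p.length = n ∧ OccursOnce p w}

/-- `R w`: the smallest `n ≥ 0` such that `w` has no right special factor of length `n`. -/
noncomputable def Rp (w : Word) : ℕ := sInf {n | ∀ u : Word, u.length = n → ¬ IsRightSpecial u w}

/-- `L w`: the smallest `n ≥ 0` such that `w` has no left special factor of length `n`. -/
noncomputable def Lp (w : Word) : ℕ := sInf {n | ∀ u : Word, u.length = n → ¬ IsLeftSpecial u w}

/-- A word `w` is trapezoidal if `|w| = K w + R w`. -/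
def IsTrapezoidal (w : Word) : Prop := w.length = Kp w + Rp w

/-- A finite word over `{a,b}` is Sturmian iff it is balanced: there is no word `u`
with both `aua` and `bub` factors of `w`. -/
def IsSturmian (w : Word) : Prop :=
  ¬ ∃ u : Word, ([a] ++ u ++ [a]) <:+: w ∧ ([b] ++ u ++ [b]) <:+: w

/-- A nonempty word is closed if it has a border (a proper prefix which is also a suffix)
whose only occurrences in `w` are as a prefix and as a suffix. -/
def IsClosedWord (w : Word) : Prop :=
  w ≠ [] ∧ ∃ v : Word, v <+: w ∧ v.length < w.length ∧ v <:+ w ∧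
    ∀ i : ℕ, OccursAt v w i → i = 0 ∨ i + v.length = w.length

/-- A nonempty word is open if it is not closed. -/
def IsOpenWord (w : Word) : Prop := w ≠ [] ∧ ¬ IsClosedWord w

/-- Central words: `a^n`, `b^n`, or `u a b v = v b a u`. -/
def IsCentral (w : Word) : Prop :=
  (∃ n : ℕ, w = List.replicate n a) ∨ (∃ n : ℕ, w = List.replicate n b) ∨
  (∃ u v : Word, w = u ++ [a, b] ++ v ∧ w = v ++ [b, a] ++ u)

/-- The minimal period of `w`: `|w|` minus the length of the longest border of `w`. -/
noncomputable def minPeriod (w : Word) : ℕ :=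
  w.length - sSup {n | ∃ v : Word, v.length = n ∧ v <+: w ∧ v ≠ w ∧ v <:+ w}

/-- All four two-sided one-letter extensions of `v` are factors of `w`. -/
def FullyExtends (v w : Word) : Prop := ∀ c d : AB, [c] ++ v ++ [d] <:+: w

/-- No word has all of its two-sided extensions in `w`. -/
def NoFullExtension (w : Word) : Prop := ∀ v, ¬ FullyExtends v w

theorem AB.eq_or_eq {x y : AB} (h : x ≠ y) (z : AB) : z = x ∨ z = y := by
  cases x <;> cases y <;> cases z <;> simp_all

theorem AB.exists_ne (x : AB) : ∃ y, x ≠ y := by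
  cases x
  · exact ⟨b, by simp⟩
  · exact ⟨a, by simp⟩

theorem NoFullExtension.of_infix {v w : Word} (h : NoFullExtension w) (hv : v <:+: w) :
    NoFullExtension v :=
  fun s hs => h s fun c d => (hs c d).trans hv

/-! ### Counting right special factors and repeated suffixes -/

/-- The repeated suffixes of `w`. -/
def repeatedSuffixes (w : Word) : Set Word := {u | u <:+ w ∧ ∃ c, u ++ [c] <:+: w}

/-- The right special factors of `w`. -/
def rightSpecials (w : Word) : Set Word := {u | IsRightSpecial u w}

theorem finite_infixes (w : Word) : {u : Word | u <:+: w}.Finite := by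
  have : {u : Word | u <:+: w} ⊆ (fun p : ℕ × ℕ => (w.drop p.1).take p.2) ''
      (Set.Iic w.length ×ˢ Set.Iic w.length) := by
    rintro u ⟨l, r, rfl⟩
    refine ⟨(l.length, u.length), ?_, ?_⟩
    · simp; omega
    · simp
  exact (((Set.finite_Iic _).prod (Set.finite_Iic _)).image _).subset this

theorem finite_suffixes (w : Word) : {u : Word | u <:+ w}.Finite :=
  (finite_infixes w).subset fun _ h => h.isInfix

theorem finite_rightSpecials (w : Word) : (rightSpecials w).Finite :=
  (finite_infixes w).subset fun u h => (List.prefix_append u [a]).isInfix.trans h.1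

theorem occursAt_iff {u w : Word} {i : ℕ} :
    OccursAt u w i ↔ ∃ l r, w = l ++ u ++ r ∧ l.length = i := by
  constructor
  · rintro ⟨h1, h2⟩
    refine ⟨w.take i, w.drop (i + u.length), ?_, ?_⟩
    · conv_lhs => rw [← List.take_append_drop i w, ← List.take_append_drop u.length (w.drop i), h2]
      simp [List.drop_drop]
    · simp; omega
  · rintro ⟨l, r, rfl, rfl⟩
    exact ⟨by simp, by simp⟩

theorem occursOnce_iff_of_suffix {u w : Word} (h : u <:+ w) :
    OccursOnce u w ↔ ¬ ∃ c, u ++ [c] <:+: w := by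
  obtain ⟨t, rfl⟩ := h
  constructor
  · rintro ⟨i, -, hi⟩ ⟨c, l, r, hw⟩
    have h1 := hi t.length (occursAt_iff.2 ⟨t, [], by simp, rfl⟩)
    have h2 := hi l.length (occursAt_iff.2 ⟨l, [c] ++ r, by simp [← hw], rfl⟩)
    have := congrArg List.length hw
    simp at this
    omega
  · intro hn
    refine ⟨t.length, occursAt_iff.2 ⟨t, [], by simp, rfl⟩, ?_⟩
    intro i hi
    obtain ⟨l, r, hw, rfl⟩ := occursAt_iff.1 hi
    rcases r with _ | ⟨c, r⟩
    · have := congrArg List.length hw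
      simp at this
      omega
    · exact absurd ⟨c, l, r, by simp [hw]⟩ hn

theorem repeatedSuffixes_of_suffix {u v w : Word} (hu : u ∈ repeatedSuffixes w) (hv : v <:+ u) :
    v ∈ repeatedSuffixes w := by
  obtain ⟨h1, c, h2⟩ := hu
  refine ⟨hv.trans h1, c, List.IsInfix.trans ?_ h2⟩
  obtain ⟨t, rfl⟩ := hv
  exact ⟨t, [], by simp⟩

theorem isRightSpecial_of_suffix {u v w : Word} (hu : IsRightSpecial u w) (hv : v <:+ u) :
    IsRightSpecial v w := by
  obtain ⟨t, rfl⟩ := hv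
  exact ⟨List.IsInfix.trans ⟨t, [], by simp⟩ hu.1, List.IsInfix.trans ⟨t, [], by simp⟩ hu.2⟩

theorem suffix_of_length_le {u v w : Word} (hu : u <:+ w) (hv : v <:+ w)
    (h : u.length ≤ v.length) : u <:+ v :=
  List.suffix_of_suffix_length_le hu hv h

theorem Kp_eq_ncard (w : Word) : Kp w = (repeatedSuffixes w).ncard := by
  have hex : Kp w ∈ {n | ∃ s : Word, s <:+ w ∧ s.length = n ∧ OccursOnce s w} := by
    refine Nat.sInf_mem ⟨w.length, w, List.suffix_rfl, rfl, ?_⟩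
    rw [occursOnce_iff_of_suffix List.suffix_rfl]
    rintro ⟨c, h⟩
    have := h.length_le
    simp at this
  obtain ⟨s, hs, hsl, hs1⟩ := hex
  have hinj : Set.InjOn List.length (repeatedSuffixes w) := by
    intro u hu v hv h
    exact (suffix_of_length_le hu.1 hv.1 h.le).eq_of_length h
  rw [← hinj.ncard_image]
  have : List.length '' repeatedSuffixes w = Set.Iio (Kp w) := by
    ext n
    constructor
    · rintro ⟨u, hu, rfl⟩
      by_contra hlt
      simp only [Set.mem_Iio, not_lt] at hlt
      rw [occursOnce_iff_of_suffix hs] at hs1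
      exact hs1 (repeatedSuffixes_of_suffix hu (suffix_of_length_le hs hu.1 (by omega))).2
    · intro hn
      have hn' : n < Kp w := hn
      have hle : n ≤ w.length := by
        have := hs.length_le
        omega
      refine ⟨w.drop (w.length - n), ⟨List.drop_suffix _ _, ?_⟩, by simp; omega⟩
      by_contra hc
      rw [← occursOnce_iff_of_suffix (List.drop_suffix _ _)] at hc
      exact Nat.notMem_of_lt_sInf hn' ⟨_, List.drop_suffix _ _, by simp; omega, hc⟩
  rw [this, Set.ncard_eq_toFinset_card']
  simp

theorem Rp_eq_ncard (w : Word) : Rp w = (List.length '' rightSpecials w).ncard := by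
  have hex : Rp w ∈ {n | ∀ u : Word, u.length = n → ¬ IsRightSpecial u w} := by
    refine Nat.sInf_mem ⟨w.length, fun u hu h => ?_⟩
    have := h.1.length_le
    simp at this
    omega
  have : List.length '' rightSpecials w = Set.Iio (Rp w) := by
    ext n
    constructor
    · rintro ⟨u, hu, rfl⟩
      by_contra hlt
      simp only [Set.mem_Iio, not_lt] at hlt
      exact hex (u.drop (u.length - Rp w)) (by simp; omega)
        (isRightSpecial_of_suffix hu (List.drop_suffix _ _))
    · intro hn
      have := Nat.notMem_of_lt_sInf (show n < Rp w from hn)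
      simp only [Set.mem_ofPred_eq, not_forall, not_not] at this
      obtain ⟨u, hu, hr⟩ := this
      exact ⟨u, hr, hu⟩
  rw [this, Set.ncard_eq_toFinset_card']
  simp

theorem infix_concat_iff {u w : Word} {x c : AB} :
    u ++ [c] <:+: w ++ [x] ↔ u ++ [c] <:+: w ∨ (c = x ∧ u <:+ w) := by
  rw [List.infix_concat_iff]
  constructor
  · rintro (h | h)
    · obtain ⟨t, ht⟩ := h
      rw [← List.append_assoc] at ht
      obtain ⟨h1, h2⟩ := List.append_inj' ht rfl
      exact Or.inr ⟨by simpa using h2, t, h1⟩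
    · exact Or.inl h
  · rintro (h | ⟨rfl, t, rfl⟩)
    · exact Or.inr h
    · exact Or.inl ⟨t, by simp⟩

theorem isRightSpecial_iff {u w : Word} {x y : AB} (h : x ≠ y) :
    IsRightSpecial u w ↔ u ++ [x] <:+: w ∧ u ++ [y] <:+: w := by
  unfold IsRightSpecial
  cases x <;> cases y <;> simp_all [and_comm]

theorem length_eq_ncard_add_ncard (w : Word) :
    w.length = (repeatedSuffixes w).ncard + (rightSpecials w).ncard := by
  induction w using List.reverseRecOn with
  | nil => simp [repeatedSuffixes, rightSpecials, IsRightSpecial]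
  | append_singleton w x ih =>
    obtain ⟨y, hxy⟩ := AB.exists_ne x
    set X : Set Word := {u | u <:+ w ∧ u ++ [x] <:+: w} with hX
    set Y : Set Word := {u | u <:+ w ∧ u ++ [y] <:+: w ∧ ¬ u ++ [x] <:+: w} with hY
    have hXf : X.Finite := (finite_suffixes w).subset fun _ h => h.1
    have hYf : Y.Finite := (finite_suffixes w).subset fun _ h => h.1
    have h1 : repeatedSuffixes w = X ∪ Y := by
      ext u
      simp only [repeatedSuffixes, hX, hY, Set.mem_ofPred_eq, Set.mem_union]
      constructor
      · rintro ⟨h, c, hc⟩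
        by_cases hx : u ++ [x] <:+: w
        · exact Or.inl ⟨h, hx⟩
        · rcases AB.eq_or_eq hxy c with rfl | rfl
          · exact absurd hc hx
          · exact Or.inr ⟨h, hc, hx⟩
      · rintro (⟨h, hc⟩ | ⟨h, hc, -⟩)
        · exact ⟨h, _, hc⟩
        · exact ⟨h, _, hc⟩
    have h2 : rightSpecials (w ++ [x]) = rightSpecials w ∪ Y := by
      ext u
      simp only [rightSpecials, hY, Set.mem_ofPred_eq, Set.mem_union, isRightSpecial_iff hxy,
        infix_concat_iff]
      have := hxy.symm
      tauto
    have h3 : repeatedSuffixes (w ++ [x]) = insert [] ((fun u => u ++ [x]) '' X) := by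
      ext u
      simp only [repeatedSuffixes, hX, Set.mem_ofPred_eq, Set.mem_insert_iff, Set.mem_image]
      constructor
      · rintro ⟨h, c, hc⟩
        rcases List.suffix_concat_iff.1 h with h | ⟨t, rfl, ht⟩
        · exact Or.inl h
        · refine Or.inr ⟨t, ⟨ht, ?_⟩, rfl⟩
          rcases infix_concat_iff.1 hc with h | h
          · exact (List.prefix_append _ _).isInfix.trans h
          · exact h.2.isInfix
      · rintro (rfl | ⟨t, ⟨h1, l, r, h2⟩, rfl⟩)
        · exact ⟨List.nil_suffix, x, w, [], by simp⟩
        · refine ⟨List.suffix_concat_iff.2 (Or.inr ⟨t, rfl, h1⟩), ?_⟩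
          rcases r with _ | ⟨c, r⟩
          · exact ⟨x, l, [], by simp [← h2]⟩
          · exact ⟨c, l, r ++ [x], by simp [← h2]⟩
    rw [h1, Set.ncard_union_eq _ hXf hYf] at ih
    · rw [h2, h3, Set.ncard_union_eq _ (finite_rightSpecials w) hYf,
        Set.ncard_insert_of_notMem (by simp) (hXf.image _), Set.ncard_image_of_injective]
      · simp; omega
      · intro u v h
        simpa using h
      · rw [Set.disjoint_left]
        rintro u hu ⟨-, -, h⟩
        exact h ((isRightSpecial_iff hxy).1 hu).1
    · rw [Set.disjoint_left]
      rintro u ⟨-, hu⟩ ⟨-, -, h⟩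
      exact h hu

theorem exists_cons_suffix_of_ne {u v : Word} (hl : u.length = v.length) (h : u ≠ v) :
    ∃ x y t, x ≠ y ∧ x :: t <:+ u ∧ y :: t <:+ v := by
  induction u generalizing v with
  | nil => cases v <;> simp_all
  | cons c u ih =>
    rcases v with _ | ⟨d, v⟩
    · simp at hl
    · by_cases huv : u = v
      · subst huv
        exact ⟨c, d, u, by simpa using h, List.suffix_rfl, List.suffix_rfl⟩
      · obtain ⟨x, y, t, hxy, h1, h2⟩ := ih (by simpa using hl) huv
        exact ⟨x, y, t, hxy, h1.trans (List.suffix_cons _ _), h2.trans (List.suffix_cons _ _)⟩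

theorem isTrapezoidal_iff (w : Word) : IsTrapezoidal w ↔ NoFullExtension w := by
  have key : IsTrapezoidal w ↔ Set.InjOn List.length (rightSpecials w) := by
    rw [← Set.ncard_image_iff (finite_rightSpecials w), IsTrapezoidal, Kp_eq_ncard, Rp_eq_ncard]
    have := length_eq_ncard_add_ncard w
    omega
  rw [key]
  constructor
  · intro h v hv
    have : [a] ++ v = [b] ++ v := h ⟨hv a a, hv a b⟩ ⟨hv b a, hv b b⟩ (by simp)
    simp at this
  · intro h u hu v hv hl
    by_contra hne
    obtain ⟨x, y, t, hxy, h1, h2⟩ := exists_cons_suffix_of_ne hl hne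
    refine h t fun c d => ?_
    have hx := isRightSpecial_of_suffix hu h1
    have hy := isRightSpecial_of_suffix hv h2
    rcases AB.eq_or_eq hxy c with rfl | rfl <;> cases d
    exacts [hx.1, hx.2, hy.1, hy.2]

/-! ### The elementary morphisms -/

/-- The morphism fixing `x` and sending the other letter `y` to `xy`. -/
def insertBefore (x : AB) (w : Word) : Word := w.flatMap fun z => if z = x then [x] else [x, z]

section insertBefore

variable {x y : AB}

@[simp] theorem insertBefore_nil : insertBefore x [] = [] := rfl

@[simp] theorem insertBefore_append (u v : Word) :
    insertBefore x (u ++ v) = insertBefore x u ++ insertBefore x v := by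
  simp [insertBefore]

@[simp] theorem insertBefore_cons_self (w : Word) :
    insertBefore x (x :: w) = x :: insertBefore x w := by
  simp [insertBefore]

theorem insertBefore_cons_of_ne (h : x ≠ y) (w : Word) :
    insertBefore x (y :: w) = x :: y :: insertBefore x w := by
  simp [insertBefore, h.symm]

theorem insertBefore_flatten_replicate (n : ℕ) (w : Word) :
    insertBefore x (List.replicate n w).flatten =
      (List.replicate n (insertBefore x w)).flatten := by
  induction n with
  | zero => simp
  | succ n ih => simp [List.replicate_succ, ih]

theorem insertBefore_replicate_self (n : ℕ) :
    insertBefore x (List.replicate n x) = List.replicate n x := by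
  induction n with
  | zero => rfl
  | succ n ih => simp [List.replicate_succ, ih]

theorem insertBefore_cons (c : AB) (w : Word) :
    insertBefore x (c :: w) = insertBefore x [c] ++ insertBefore x w :=
  insertBefore_append [c] w

theorem insertBefore_append_eq_cons (w : Word) :
    ∃ r, insertBefore x w ++ [x] = x :: r := by
  rcases w with _ | ⟨c, w⟩
  · exact ⟨[], rfl⟩
  · by_cases h : x = c
    · subst h
      simp
    · simp [insertBefore_cons_of_ne h]

theorem exists_insertBefore_singleton (c : AB) : ∃ l, insertBefore x [c] = l ++ [c] := by
  by_cases h : x = c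
  · subst h
    exact ⟨[], by simp⟩
  · exact ⟨[x], by simp [insertBefore_cons_of_ne h]⟩

/-- `x` followed by the first letter after it determines the first block. -/
theorem exists_insertBefore_append (c : AB) (w : Word) :
    ∃ r, insertBefore x (c :: w) ++ [x] = x :: c :: r := by
  by_cases h : x = c
  · subst h
    obtain ⟨r, hr⟩ := insertBefore_append_eq_cons (x := x) w
    exact ⟨r, by simp [hr]⟩
  · exact ⟨insertBefore x w ++ [x], by simp [insertBefore_cons_of_ne h]⟩

theorem insertBefore_split {w L R : Word} (h : insertBefore x w ++ [x] = L ++ x :: R) :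
    ∃ w₁ w₂, w = w₁ ++ w₂ ∧ insertBefore x w₁ = L ∧ insertBefore x w₂ ++ [x] = x :: R := by
  induction w generalizing L with
  | nil =>
    rcases L with _ | ⟨l, L⟩
    · exact ⟨[], [], rfl, rfl, by simpa using h⟩
    · simp at h
  | cons c w ih =>
    rcases L with _ | ⟨l, L⟩
    · exact ⟨[], c :: w, rfl, rfl, by simpa using h⟩
    by_cases hc : x = c
    · subst hc
      simp only [insertBefore_cons_self, List.cons_append, List.cons.injEq] at h
      obtain ⟨w₁, w₂, rfl, h1, h2⟩ := ih h.2
      exact ⟨x :: w₁, w₂, rfl, by simp [h1, ← h.1], h2⟩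
    · simp only [insertBefore_cons_of_ne hc, List.cons_append, List.cons.injEq] at h
      rcases L with _ | ⟨l', L⟩
      · exact absurd (List.cons.inj h.2).1.symm hc
      · simp only [List.cons_append, List.cons.injEq] at h
        obtain ⟨w₁, w₂, rfl, h1, h2⟩ := ih h.2.2
        exact ⟨c :: w₁, w₂, rfl, by simp [insertBefore_cons_of_ne hc, h1, ← h.1, ← h.2.1], h2⟩

theorem insertBefore_injective : Function.Injective (insertBefore x) := by
  intro u v h
  induction u generalizing v with
  | nil =>
    rcases v with _ | ⟨d, v⟩
    · rfl
    · by_cases hd : x = d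
      · subst hd; simp at h
      · simp [insertBefore_cons_of_ne hd] at h
  | cons c u ih =>
    rcases v with _ | ⟨d, v⟩
    · by_cases hd : x = c
      · subst hd; simp at h
      · simp [insertBefore_cons_of_ne hd] at h
    · have h' := congrArg (· ++ [x]) h
      obtain ⟨r, hr⟩ := exists_insertBefore_append (x := x) c u
      obtain ⟨r', hr'⟩ := exists_insertBefore_append (x := x) d v
      simp only [hr, hr', List.cons.injEq] at h'
      obtain rfl := h'.2.1
      rw [insertBefore_cons c u, insertBefore_cons c v] at h
      rw [ih (List.append_cancel_left h)]

theorem exists_insertBefore_eq (hxy : x ≠ y) {w : Word} (hw : ¬ [y, y] <:+: w) :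
    ∃ w', insertBefore x w' = w ∨ (insertBefore x w' = x :: w ∧ ∃ r, w = y :: r) := by
  induction w with
  | nil => exact ⟨[], Or.inl rfl⟩
  | cons c w ih =>
    obtain ⟨w', h⟩ := ih fun h => hw (h.trans (List.suffix_cons _ _).isInfix)
    rcases AB.eq_or_eq hxy c with rfl | rfl
    · rcases h with h | ⟨h, -⟩
      · exact ⟨c :: w', Or.inl (by simp [h])⟩
      · exact ⟨w', Or.inl h⟩
    · rcases h with h | ⟨h, r, rfl⟩
      · exact ⟨c :: w', Or.inr ⟨by simp [insertBefore_cons_of_ne hxy, h], w, rfl⟩⟩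
      · exact absurd ⟨[], r, by simp⟩ hw

theorem length_le_length_insertBefore (w : Word) : w.length ≤ (insertBefore x w).length := by
  induction w with
  | nil => simp
  | cons c w ih =>
    by_cases hc : x = c
    · subst hc; simp; omega
    · simp [insertBefore_cons_of_ne hc]; omega

theorem length_lt_length_insertBefore (hxy : x ≠ y) {w : Word} (h : y ∈ insertBefore x w) :
    w.length < (insertBefore x w).length := by
  induction w with
  | nil => simp at h
  | cons c w ih =>
    by_cases hc : x = c
    · subst hc
      simp only [insertBefore_cons_self, List.mem_cons, hxy.symm, false_or] at h
      simpa using ih h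
    · have := length_le_length_insertBefore (x := x) w
      simp [insertBefore_cons_of_ne hc]; omega

theorem not_infix_insertBefore (hxy : x ≠ y) (w : Word) :
    ¬ [y, y] <:+: insertBefore x w ++ [x] := by
  induction w with
  | nil =>
    intro h
    simpa using h.length_le
  | cons c w ih =>
    intro h
    have hx : ∀ r : Word, ¬ [y, y] <+: x :: r := by
      rintro r ⟨t, ht⟩
      simp [hxy.symm] at ht
    by_cases hc : x = c
    · subst hc
      rw [insertBefore_cons_self, List.cons_append, List.infix_cons_iff] at h
      exact h.elim (hx _) ih
    · rw [insertBefore_cons_of_ne hc, List.cons_append, List.infix_cons_iff] at h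
      refine h.elim (hx _) fun h => ?_
      rw [List.cons_append, List.infix_cons_iff] at h
      refine h.elim ?_ ih
      obtain ⟨r, hr⟩ := insertBefore_append_eq_cons (x := x) w
      rw [hr]
      rintro ⟨t, ht⟩
      simp [hxy.symm] at ht

theorem infix_of_infix_insertBefore {v w : Word} {c d : AB}
    (h : [c] ++ (insertBefore x v ++ [x]) ++ [d] <:+: insertBefore x w ++ [x]) :
    [c] ++ v ++ [d] <:+: w := by
  obtain ⟨l, r, h⟩ := h
  obtain ⟨s, hs⟩ := insertBefore_append_eq_cons (x := x) v
  have h1 : insertBefore x w ++ [x] = (l ++ [c]) ++ x :: (s ++ d :: r) := by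
    rw [← h, hs]; simp
  obtain ⟨w₁, w₂, rfl, e1, e2⟩ := insertBefore_split h1
  have h2 : insertBefore x w₂ ++ [x] = insertBefore x v ++ x :: (d :: r) := by
    rw [e2, ← List.cons_append, ← hs]; simp
  obtain ⟨w₃, w₄, rfl, e3, e4⟩ := insertBefore_split h2
  obtain rfl := insertBefore_injective e3
  rcases w₄ with _ | ⟨d', w₄⟩
  · simp at e4
  obtain ⟨r', hr'⟩ := exists_insertBefore_append (x := x) d' w₄
  rw [hr'] at e4
  simp only [List.cons.injEq, true_and] at e4
  obtain rfl := e4.1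
  rcases List.eq_nil_or_concat w₁ with rfl | ⟨w₁, c', rfl⟩
  · simp at e1
  obtain ⟨l', hl'⟩ := exists_insertBefore_singleton (x := x) c'
  rw [List.concat_eq_append, insertBefore_append, hl', ← List.append_assoc] at e1
  have := (List.append_inj' e1 rfl).2
  simp only [List.cons.injEq, and_true] at this
  subst this
  exact ⟨w₁, w₄, by simp⟩

theorem infix_insertBefore_of_infix {v w : Word} {c d : AB} (h : [c] ++ v ++ [d] <:+: w) :
    [c] ++ (insertBefore x v ++ [x]) ++ [d] <:+: insertBefore x w ++ [x] := by
  obtain ⟨l, r, rfl⟩ := h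
  obtain ⟨l', hl'⟩ := exists_insertBefore_singleton (x := x) c
  obtain ⟨r', hr'⟩ := exists_insertBefore_append (x := x) d r
  refine ⟨insertBefore x l ++ l', r', ?_⟩
  have : l ++ ([c] ++ v ++ [d]) ++ r = l ++ ([c] ++ (v ++ d :: r)) := by simp
  rw [this]
  simp only [insertBefore_append, hl', List.append_assoc, hr']
  simp

theorem infix_insertBefore_of_infix_of_ne {v w : Word} {c : AB} (hxy : x ≠ y)
    (h : [c] ++ v ++ [y] <:+: w) :
    [c] ++ (insertBefore x v ++ [x]) ++ [y] <:+: insertBefore x w := by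
  obtain ⟨l, r, rfl⟩ := h
  obtain ⟨l', hl'⟩ := exists_insertBefore_singleton (x := x) c
  refine ⟨insertBefore x l ++ l', insertBefore x r, ?_⟩
  simp only [insertBefore_append, hl', insertBefore_cons_of_ne hxy]
  simp

theorem NoFullExtension.insertBefore_append {w : Word} (h : NoFullExtension w) :
    NoFullExtension (insertBefore x w ++ [x]) := by
  intro V hV
  obtain ⟨y, hxy⟩ := AB.exists_ne x
  have hn := not_infix_insertBefore hxy w
  have hVinf : V <:+: insertBefore x w ++ [x] := List.IsInfix.trans ⟨[y], [y], rfl⟩ (hV y y)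
  rcases List.eq_nil_or_concat V with rfl | ⟨V, z, rfl⟩
  · exact hn (hV y y)
  rw [List.concat_eq_append] at hV hVinf
  have hz : z = x := by
    refine (AB.eq_or_eq hxy z).resolve_right ?_
    rintro rfl
    exact hn (List.IsInfix.trans ⟨z :: V, [], by simp⟩ (hV z z))
  subst hz
  obtain ⟨v, hv | ⟨-, r, rfl⟩⟩ := exists_insertBefore_eq hxy (w := V)
    fun h => hn (h.trans ((List.prefix_append _ _).isInfix.trans hVinf))
  · subst hv
    exact h v fun c d => infix_of_infix_insertBefore (hV c d)
  · exact hn (List.IsInfix.trans ⟨[], r ++ [z, y], by simp⟩ (hV y y))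

end insertBefore

/-- Both one-letter right extensions of `w` have no full extension. -/
def RightExtendable (w : Word) : Prop := ∀ c, NoFullExtension (w ++ [c])

theorem RightExtendable.of_suffix {v w : Word} (h : RightExtendable w) (hv : v <:+ w) :
    RightExtendable v := by
  intro c
  obtain ⟨t, rfl⟩ := hv
  exact (h c).of_infix ⟨t, [], by simp⟩

theorem RightExtendable.insertBefore_append {x : AB} {w : Word} (h : RightExtendable w) :
    RightExtendable (insertBefore x w ++ [x]) := by
  intro c
  have := (h c).insertBefore_append (x := x)
  by_cases hc : x = c
  · subst hc
    simpa using this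
  · refine this.of_infix ⟨[], [x], ?_⟩
    simp [insertBefore_cons_of_ne hc]

theorem RightExtendable.of_insertBefore {x y : AB} (hxy : x ≠ y) {w W : Word}
    (hW : RightExtendable W)
    (h : insertBefore x w ++ [x] = W ∨ (insertBefore x w ++ [x] = x :: W ∧ ∃ r, W = y :: r)) :
    RightExtendable w := by
  intro d v hv
  have key : ∀ c e,
      [c] ++ (insertBefore x v ++ [x]) ++ [e] <:+: (insertBefore x w ++ [x]) ++ [d] := by
    intro c e
    rcases AB.eq_or_eq hxy d with rfl | rfl
    · simpa using infix_insertBefore_of_infix (x := d) (hv c e)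
    · rcases AB.eq_or_eq hxy e with rfl | rfl
      · have := (infix_concat_iff.1 (hv c e)).resolve_right fun h => hxy h.1
        exact (infix_insertBefore_of_infix this).trans (List.prefix_append _ _).isInfix
      · simpa [insertBefore_cons_of_ne hxy] using infix_insertBefore_of_infix_of_ne hxy (hv c e)
  rcases h with rfl | ⟨h, r, rfl⟩
  · exact hW d _ key
  · refine hW d (insertBefore x v ++ [x]) fun c e => ?_
    have := key c e
    rw [h, List.cons_append (bs := [d]), List.infix_cons_iff] at this
    refine this.resolve_left ?_
    obtain ⟨s, hs⟩ := insertBefore_append_eq_cons (x := x) v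
    rw [hs]
    rintro ⟨t, ht⟩
    simp [hxy] at ht

/-! ### Standard pairs and central words -/

/-- `StandardPair P u`: the words `P a` and `P b` form a standard pair with central word `u`. -/
inductive StandardPair : (AB → Word) → Word → Prop
  | base : StandardPair (fun z => [z]) []
  | step (x : AB) {P : AB → Word} {u : Word} (h : StandardPair P u) :
      StandardPair (fun z => insertBefore x (P z)) (insertBefore x u ++ [x])

theorem isCentral_iff {w : Word} :
    IsCentral w ↔ (∃ x n, w = List.replicate n x) ∨
      ∃ x y s t, x ≠ y ∧ w = s ++ [x, y] ++ t ∧ w = t ++ [y, x] ++ s := by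
  constructor
  · rintro (⟨n, h⟩ | ⟨n, h⟩ | ⟨s, t, h1, h2⟩)
    · exact Or.inl ⟨a, n, h⟩
    · exact Or.inl ⟨b, n, h⟩
    · exact Or.inr ⟨a, b, s, t, by simp, h1, h2⟩
  · rintro (⟨x, n, h⟩ | ⟨x, y, s, t, hxy, h1, h2⟩)
    · cases x
      · exact Or.inl ⟨n, h⟩
      · exact Or.inr (Or.inl ⟨n, h⟩)
    · cases x <;> cases y
      · exact absurd rfl hxy
      · exact Or.inr (Or.inr ⟨s, t, h1, h2⟩)
      · exact Or.inr (Or.inr ⟨t, s, h2, h1⟩)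
      · exact absurd rfl hxy

theorem IsCentral.insertBefore_append (z : AB) {u : Word} (h : IsCentral u) :
    IsCentral (insertBefore z u ++ [z]) := by
  rw [isCentral_iff] at h ⊢
  rcases h with ⟨x, n, rfl⟩ | ⟨x, y, s, t, hxy, h1, h2⟩
  · by_cases hz : z = x
    · subst hz
      refine Or.inl ⟨z, n + 1, ?_⟩
      rw [List.replicate_succ', insertBefore_replicate_self]
    · rcases n with _ | n
      · exact Or.inl ⟨z, 1, rfl⟩
      · refine Or.inr ⟨z, x, [], insertBefore z (List.replicate n x) ++ [z], hz, ?_, ?_⟩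
        · simp [List.replicate_succ, insertBefore_cons_of_ne hz]
        · simp [List.replicate_succ', insertBefore_cons_of_ne hz]
  · refine Or.inr ⟨x, y, insertBefore z s ++ [z], insertBefore z t ++ [z], hxy, ?_, ?_⟩
    · rw [h1]
      rcases AB.eq_or_eq hxy z with rfl | rfl
      · simp [insertBefore_cons_of_ne hxy]
      · simp [insertBefore_cons_of_ne hxy.symm]
    · rw [h2]
      rcases AB.eq_or_eq hxy z with rfl | rfl
      · simp [insertBefore_cons_of_ne hxy]
      · simp [insertBefore_cons_of_ne hxy.symm]

theorem eq_replicate_of_cons_eq_append {y : AB} {t : Word} (h : y :: t = t ++ [y]) :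
    t = List.replicate t.length y := by
  induction t with
  | nil => rfl
  | cons c t ih =>
    simp only [List.cons_append, List.cons.injEq] at h
    obtain ⟨rfl, h⟩ := h
    rw [List.length_cons, List.replicate_succ, ← ih h]

namespace StandardPair

variable {P : AB → Word} {u : Word} {x y : AB}

theorem isCentral (h : StandardPair P u) : IsCentral u := by
  induction h with
  | base => exact Or.inl ⟨0, rfl⟩
  | step z _ ih => exact ih.insertBefore_append z

theorem append_eq (h : StandardPair P u) (hxy : x ≠ y) : P x ++ P y = u ++ [x, y] := by
  induction h with
  | base => rfl
  | step z _ ih =>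
    rw [← insertBefore_append, ih]
    rcases AB.eq_or_eq hxy z with rfl | rfl
    · simp [insertBefore_cons_of_ne hxy]
    · simp [insertBefore_cons_of_ne hxy.symm]

theorem exists_eq_append (h : StandardPair P u) (x : AB) : ∃ l, P x = l ++ [x] := by
  induction h with
  | base => exact ⟨[], rfl⟩
  | step z _ ih =>
    obtain ⟨l, hl⟩ := ih
    obtain ⟨l', hl'⟩ := exists_insertBefore_singleton (x := z) x
    exact ⟨insertBefore z l ++ l', by simp [hl, hl']⟩

theorem length_pos (h : StandardPair P u) (x : AB) : 0 < (P x).length := by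
  obtain ⟨l, hl⟩ := h.exists_eq_append x
  simp [hl]

theorem length_add_length (h : StandardPair P u) (hxy : x ≠ y) :
    (P x).length + (P y).length = u.length + 2 := by
  simpa using congrArg List.length (h.append_eq hxy)

/-- Replacing `P y` by `P x ++ P y`. -/
theorem append (h : StandardPair P u) (x : AB) :
    StandardPair (fun z => (insertBefore x [z]).flatMap P) (P x ++ u) := by
  induction h with
  | base =>
    have := base.step x
    simpa using this
  | step w h ih =>
    have := ih.step w
    convert this using 1
    · funext z
      by_cases hz : x = z
      · subst hz; simp
      · simp [insertBefore_cons_of_ne hz]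
    · simp

theorem exists_of_replicate (n : ℕ) (y : AB) :
    ∃ P, StandardPair P (List.replicate n y) ∧ P y = [y] ∧
      ∀ x, x ≠ y → P x = List.replicate n y ++ [x] := by
  induction n with
  | zero => exact ⟨_, base, rfl, fun _ _ => rfl⟩
  | succ n ih =>
    obtain ⟨P, hP, h1, h2⟩ := ih
    refine ⟨_, by simpa [insertBefore_replicate_self, ← List.replicate_succ'] using hP.step y,
      by simp [h1], fun x hx => ?_⟩
    simp [h2 x hx, insertBefore_replicate_self, insertBefore_cons_of_ne hx.symm,
      List.replicate_succ']

theorem exists_of_eq {s t : Word} (hxy : x ≠ y) (h : s ++ [x, y] ++ t = t ++ [y, x] ++ s) :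
    ∃ P, StandardPair P (s ++ [x, y] ++ t) ∧ P x = t ++ [y, x] ∧ P y = s ++ [x, y] := by
  induction hn : s.length + t.length using Nat.strong_induction_on generalizing s t x y with
  | _ n ih =>
  wlog hst : t.length ≤ s.length generalizing s t x y
  · obtain ⟨P, h1, h2, h3⟩ := this hxy.symm h.symm (by omega) (by omega)
    exact ⟨P, h ▸ h1, h3, h2⟩
  rcases hst.lt_or_eq with hlt | heq
  · have hpre : t ++ [y] <+: s := by
      refine List.prefix_of_prefix_length_le (l₃ := s ++ [x, y] ++ t) ⟨x :: s, by simp [h]⟩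
        ⟨[x, y] ++ t, by simp⟩ (by simpa using hlt)
    obtain ⟨r, rfl⟩ := hpre
    simp only [List.append_assoc, List.append_cancel_left_eq, List.cons_append, List.nil_append,
      List.cons.injEq, true_and] at h
    rcases r with _ | ⟨c, r⟩
    · simp only [List.nil_append, List.cons.injEq, true_and] at h
      have ht := eq_replicate_of_cons_eq_append h
      obtain ⟨P, hP, h1, h2⟩ := exists_of_replicate (t.length + 1) y
      replace h2 := h2 x hxy
      refine ⟨_, by simpa [h2, List.replicate_succ', ← ht, h] using hP.append x, ?_, ?_⟩
      · simp [h2, List.replicate_succ', ← ht]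
      · simp [insertBefore_cons_of_ne hxy, h1, h2, List.replicate_succ', ← ht]
    · simp only [List.cons_append, List.cons.injEq] at h
      obtain ⟨rfl, h⟩ := h
      obtain ⟨P, hP, h1, h2⟩ := ih _ (by simp at hn; omega) (s := r) (t := t) hxy
        (by simpa using h) rfl
      have h' : r ++ [c, y] ++ t = t ++ [y, c] ++ r := by simpa using h
      refine ⟨_, by simpa [h1, h] using hP.append c, ?_, ?_⟩
      · simp [h1]
      · simp [insertBefore_cons_of_ne hxy, h1, h2]
  · have := List.append_inj_left (by simpa using h : s ++ (x :: y :: t) = t ++ (y :: x :: s))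
      heq.symm
    subst this
    simp [hxy] at h

theorem exists_of_isCentral (h : IsCentral u) : ∃ P, StandardPair P u := by
  rw [isCentral_iff] at h
  rcases h with ⟨x, n, rfl⟩ | ⟨x, y, s, t, hxy, rfl, h2⟩
  · obtain ⟨P, hP, -⟩ := exists_of_replicate n x
    exact ⟨P, hP⟩
  · obtain ⟨P, hP, -⟩ := exists_of_eq hxy h2
    exact ⟨P, hP⟩

end StandardPair

/-! ### Periods -/

theorem minPeriod_isLeast {w : Word} (hw : w ≠ []) :
    IsLeast {q | 0 < q ∧ q ≤ w.length ∧ w.drop q <+: w} (minPeriod w) := by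
  set S := {n | ∃ v : Word, v.length = n ∧ v <+: w ∧ v ≠ w ∧ v <:+ w} with hS
  have hbdd : BddAbove S := ⟨w.length, by rintro n ⟨v, rfl, h, -⟩; exact h.length_le⟩
  have hmem : sSup S ∈ S :=
    Nat.sSup_mem ⟨0, [], rfl, List.nil_prefix, hw.symm, List.nil_suffix⟩ hbdd
  have hmin : minPeriod w = w.length - sSup S := rfl
  constructor
  · obtain ⟨v, hl, hp, hne, hs⟩ := hmem
    have hlt : v.length < w.length :=
      lt_of_le_of_ne hp.length_le fun h => hne (hp.eq_of_length h)
    refine ⟨by omega, by omega, ?_⟩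
    rw [hmin, ← hl]
    rwa [← List.suffix_iff_eq_drop.1 hs]
  · rintro q ⟨h0, hq, hp⟩
    have : w.length - q ≤ sSup S := by
      refine le_csSup hbdd ⟨w.drop q, by simp, hp, fun h => ?_, List.drop_suffix _ _⟩
      have := congrArg List.length h
      simp at this
      omega
    omega

theorem drop_prefix_of_suffix {t w : Word} {q : ℕ} (h : w.drop q <+: w) (ht : t <:+ w) :
    t.drop q <+: t := by
  obtain ⟨r, rfl⟩ := ht
  have := h.drop r.length
  have e : ((r ++ t).drop q).drop r.length = t.drop q := by
    rw [List.drop_drop, Nat.add_comm, ← List.drop_drop, List.drop_left]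
  rwa [e, List.drop_left] at this

theorem drop_prefix_of_prefix {t w : Word} {q : ℕ} (h : w.drop q <+: w) (ht : t <+: w) :
    t.drop q <+: t :=
  List.prefix_of_prefix_length_le ((ht.drop q).trans h) ht (by simp)

theorem prefix_flatten_append {z e : Word} (he : e <+: z ++ e) (n : ℕ) :
    (List.replicate n z).flatten ++ e <+: z ++ ((List.replicate n z).flatten ++ e) := by
  induction n with
  | zero => simpa using he
  | succ n ih => simpa [List.replicate_succ] using ih

theorem exists_suffix_flatten {p z e : Word} (he : e <+: z ++ e) (hz : z ≠ [])
    (hle : z.length ≤ e.length) (hp : (p ++ e).drop z.length <+: p ++ e) :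
    ∃ n, p <:+ (List.replicate n z).flatten := by
  have hze : z = e.take z.length := by
    have := List.prefix_of_prefix_length_le (List.prefix_append z e) he hle
    exact List.prefix_iff_eq_take.1 this
  induction hn : p.length using Nat.strong_induction_on generalizing p with
  | _ n ih =>
  rcases lt_or_ge p.length z.length with hlt | hge
  · refine ⟨1, ?_⟩
    have h1 : e.drop (z.length - p.length) <+: p ++ e := by
      rwa [List.drop_append, List.drop_of_length_le hlt.le, List.nil_append] at hp
    have h2 : p <+: e.drop (z.length - p.length) :=
      List.prefix_of_prefix_length_le (List.prefix_append p e) h1 (by simp; omega)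
    have h3 : p = z.drop (z.length - p.length) := by
      have h4 := congrArg (List.drop (z.length - p.length)) hze
      rw [List.drop_take, Nat.sub_sub_self hlt.le] at h4
      exact (List.prefix_iff_eq_take.1 h2).trans h4.symm
    simpa using h3 ▸ List.drop_suffix _ z
  · obtain ⟨p₁, p₂, rfl, hl⟩ : ∃ p₁ p₂, p = p₁ ++ p₂ ∧ p₂.length = z.length :=
      ⟨p.take (p.length - z.length), p.drop (p.length - z.length),
        (List.take_append_drop _ _).symm, by simp; omega⟩
    have h1 : e <+: p₂ ++ e := by
      have := drop_prefix_of_suffix hp (t := p₂ ++ e) ⟨p₁, by simp⟩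
      rwa [← hl, List.drop_left] at this
    have h2 : p₂ = z := by
      rw [hze, ← hl]
      exact List.prefix_iff_eq_take.1
        (List.prefix_of_prefix_length_le (List.prefix_append _ _) h1 (by omega))
    subst h2
    have hpos := List.length_pos_iff.2 hz
    have h3 := drop_prefix_of_prefix hp (t := p₁ ++ e)
      (by simpa using he)
    obtain ⟨m, t, hm⟩ := ih p₁.length (by simp at hn; omega) h3 rfl
    exact ⟨m + 1, t, by simp [List.replicate_succ', ← hm]⟩

namespace StandardPair

variable {P : AB → Word} {u : Word} {x y : AB}

theorem suffix_of_border (h : StandardPair P u) (hxy : x ≠ y) {v : Word} (hs : v <:+ u)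
    (hp : v ++ [x] <+: u) : v ++ [x, y] <:+ P y := by
  induction h generalizing v with
  | base => simpa using hp.length_le
  | @step z P u h ih =>
    rcases List.suffix_concat_iff.1 hs with rfl | ⟨t, rfl, ht⟩
    · obtain ⟨r, hr⟩ := insertBefore_append_eq_cons (x := z) u
      obtain ⟨r', hr'⟩ := hp
      rw [hr] at hr'
      obtain rfl : x = z := by simpa using (List.cons.inj hr').1
      obtain ⟨l, hl⟩ := h.exists_eq_append y
      exact ⟨insertBefore x l, by simp [hl, insertBefore_cons_of_ne hxy]⟩
    · obtain ⟨r, hr⟩ := hp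
      obtain ⟨u₁, u₂, hu, rfl, h2⟩ := insertBefore_split (R := x :: r) (L := t) (w := u) (x := z)
        (by rw [← hr]; simp)
      have hpre : u₁ ++ [x] <+: u := by
        rcases u₂ with _ | ⟨d, u₂⟩
        · simp at h2
        · obtain ⟨r', hr'⟩ := exists_insertBefore_append (x := z) d u₂
          rw [hr'] at h2
          simp only [List.cons.injEq, true_and] at h2
          exact ⟨u₂, by simp [hu, h2.1]⟩
      have hsuf : u₁ <:+ u := by
        obtain ⟨l, hl⟩ := ht
        obtain ⟨r', hr'⟩ := insertBefore_append_eq_cons (x := z) u₁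
        obtain ⟨w₁, w₂, hw, -, h3⟩ := insertBefore_split (R := r') (L := l) (w := u) (x := z)
          (by rw [← hl, ← hr']; simp)
        rw [← hr'] at h3
        exact ⟨w₁, by rw [hw, insertBefore_injective (List.append_cancel_right h3)]⟩
      obtain ⟨l, hl⟩ := ih hsuf hpre
      refine ⟨insertBefore z l, ?_⟩
      change _ = insertBefore z (P y)
      rw [← hl]
      rcases AB.eq_or_eq hxy z with rfl | rfl
      · simp [insertBefore_cons_of_ne hxy]
      · simp [insertBefore_cons_of_ne hxy.symm]

theorem concat_prefix_append (h : StandardPair P u) (x : AB) : u ++ [x] <+: P x ++ u := by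
  obtain ⟨y, hxy⟩ := AB.exists_ne x
  have h1 := h.append_eq hxy
  have h2 := h.append_eq hxy.symm
  refine List.prefix_of_prefix_length_le (l₃ := P x ++ P y ++ P x) ⟨[y] ++ P x, by simp [h1]⟩
    ⟨[y, x], by simp [h2]⟩ ?_
  have := h.length_pos x
  simp
  omega

theorem concat_prefix_append_concat (h : StandardPair P u) (x : AB) :
    u ++ [x] <+: P x ++ (u ++ [x]) :=
  (h.concat_prefix_append x).trans ⟨[x], by simp⟩

theorem minPeriod_concat (h : StandardPair P u) (x : AB) :
    minPeriod (u ++ [x]) = (P x).length := by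
  obtain ⟨y, hxy⟩ := AB.exists_ne x
  have hlen := h.length_add_length hxy
  have hx := h.length_pos x
  have hy := h.length_pos y
  refine (minPeriod_isLeast (by simp)).unique ⟨⟨hx, by simp; omega, ?_⟩, ?_⟩
  · have := (h.concat_prefix_append x).drop (P x).length
    rw [List.drop_left] at this
    exact this.trans (List.prefix_append _ _)
  · rintro q ⟨h0, hq, hp⟩
    rcases List.suffix_concat_iff.1 (List.drop_suffix q (u ++ [x])) with h1 | ⟨t, h1, h2⟩
    · have := congrArg List.length h1
      simp at this
      omega
    · have hl := congrArg List.length h1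
      simp only [List.length_drop, List.length_append, List.length_singleton] at hl hq
      rw [h1] at hp
      have := (h.suffix_of_border hxy h2 (List.prefix_of_prefix_length_le hp
        (List.prefix_append _ _) (by simp; omega))).length_le
      simp at this
      omega

theorem length_le (h : StandardPair P u) (x : AB) : (P x).length ≤ (u ++ [x]).length := by
  obtain ⟨y, hxy⟩ := AB.exists_ne x
  have := h.length_add_length hxy
  have := h.length_pos y
  simp
  omega

theorem minPeriod_append_concat (h : StandardPair P u) {p : Word} {n : ℕ}
    (hp : p <:+ (List.replicate n (P x)).flatten) :
    minPeriod (p ++ (u ++ [x])) = (P x).length := by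
  have hle := h.length_le x
  refine (minPeriod_isLeast (by simp)).unique ⟨⟨h.length_pos x, ?_, ?_⟩, ?_⟩
  · rw [List.length_append]
    omega
  · refine drop_prefix_of_suffix (w := P x ++ ((List.replicate n (P x)).flatten ++ (u ++ [x]))) ?_
      (List.IsSuffix.trans ?_ (List.suffix_append _ _))
    · rw [List.drop_left]
      exact prefix_flatten_append (h.concat_prefix_append_concat x) n
    · obtain ⟨t, ht⟩ := hp
      exact ⟨t, by rw [← ht, List.append_assoc]⟩
  · rintro q ⟨h0, hq, hd⟩
    by_contra! hlt
    have := (minPeriod_isLeast (w := u ++ [x]) (by simp)).2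
      ⟨h0, by omega, drop_prefix_of_suffix hd (List.suffix_append _ _)⟩
    rw [h.minPeriod_concat] at this
    omega

theorem exists_suffix_of_minPeriod (h : StandardPair P u) {p : Word}
    (hp : minPeriod (p ++ (u ++ [x])) = (P x).length) :
    ∃ n, p <:+ (List.replicate n (P x)).flatten := by
  have := (minPeriod_isLeast (w := p ++ (u ++ [x])) (by simp)).1.2.2
  rw [hp] at this
  exact exists_suffix_flatten (h.concat_prefix_append_concat x)
    (List.length_pos_iff.1 (h.length_pos x)) (h.length_le x) this

/-! ### Right extendable words -/

theorem insertBefore_eq (z : AB) (hxy : x ≠ y) (n : ℕ) :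
    insertBefore z ((List.replicate n (P x)).flatten ++ (u ++ [x, y] ++ u)) ++ [z] =
      (List.replicate n (insertBefore z (P x))).flatten ++
        ((insertBefore z u ++ [z]) ++ [x, y] ++ (insertBefore z u ++ [z])) := by
  rcases AB.eq_or_eq hxy z with rfl | rfl
  · simp [insertBefore_cons_of_ne hxy, insertBefore_flatten_replicate]
  · simp [insertBefore_cons_of_ne hxy.symm, insertBefore_flatten_replicate]

theorem rightExtendable (h : StandardPair P u) (hxy : x ≠ y) (n : ℕ) :
    RightExtendable ((List.replicate n (P x)).flatten ++ (u ++ [x, y] ++ u)) := by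
  induction h with
  | base =>
    intro c v hv
    have key : ∀ d, y :: (v ++ [d]) <:+: (List.replicate (n + 1) [x]).flatten ++ [y, c] → d = c := by
      intro d
      generalize n + 1 = m
      induction m with
      | zero =>
        intro h
        have hl := h.length_le
        simp only [List.length_cons, List.length_append, List.replicate_zero, List.flatten_nil,
          List.length_nil] at hl
        obtain rfl : v = [] := List.length_eq_zero_iff.1 (by omega)
        simpa using h.eq_of_length (by simp)
      | succ m ih =>
        intro h
        simp only [List.replicate_succ, List.flatten_cons, List.cons_append, List.nil_append,
          List.infix_cons_iff] at h
        refine h.elim ?_ ih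
        rintro ⟨t, ht⟩
        simp [hxy.symm] at ht
    have hx := key x (by simpa [List.replicate_succ'] using hv y x)
    have hy := key y (by simpa [List.replicate_succ'] using hv y y)
    exact hxy (hx.trans hy.symm)
  | step z _ ih =>
    rw [← insertBefore_eq z hxy]
    exact ih.insertBefore_append

end StandardPair

theorem pair_infix_of_mem {x y : AB} (hxy : x ≠ y) {w : Word} (h : y ∈ w) :
    [y, x] <:+: w ++ [x] := by
  induction w using List.reverseRecOn with
  | nil => simp at h
  | append_singleton w c ih =>
    rcases AB.eq_or_eq hxy c with rfl | rfl
    · exact (ih (by simpa [hxy.symm] using h)).trans (List.prefix_append _ _).isInfix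
    · exact ⟨w, [], by simp⟩

theorem RightExtendable.exists_standardPair {w : Word} (h : RightExtendable w) :
    ∃ P u x y n, StandardPair P u ∧ x ≠ y ∧
      w <:+ (List.replicate n (P x)).flatten ++ (u ++ [x, y] ++ u) := by
  induction hn : w.length using Nat.strong_induction_on generalizing w with
  | _ n ih =>
  rcases List.eq_nil_or_concat w with rfl | ⟨W, x, rfl⟩
  · exact ⟨_, _, a, b, 0, .base, by simp, List.nil_suffix⟩
  rw [List.concat_eq_append] at h hn ⊢
  obtain ⟨y, hxy⟩ := AB.exists_ne x
  by_cases hyy : [y, y] <:+: W ++ [x]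
  · have hy : y ∈ W := by simpa [hxy.symm] using hyy.subset (List.mem_cons_self)
    have hyx := pair_infix_of_mem hxy hy
    have hxx : ¬ [x, x] <:+: W ++ [x] := by
      intro hxx
      refine h y [] fun c d => ?_
      have hpre : W ++ [x] <:+: W ++ [x] ++ [y] := (List.prefix_append _ _).isInfix
      rcases AB.eq_or_eq hxy c with rfl | rfl <;> rcases AB.eq_or_eq hxy d with rfl | rfl
      · exact hxx.trans hpre
      · exact ⟨W, [], by simp⟩
      · exact hyx.trans hpre
      · exact hyy.trans hpre
    have hxy' : ¬ [x, y] <:+: W ++ [x] := by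
      intro hxy'
      refine h x [] fun c d => ?_
      have hpre : W ++ [x] <:+: W ++ [x] ++ [x] := (List.prefix_append _ _).isInfix
      rcases AB.eq_or_eq hxy c with rfl | rfl <;> rcases AB.eq_or_eq hxy d with rfl | rfl
      · exact ⟨W, [], by simp⟩
      · exact hxy'.trans hpre
      · exact hyx.trans hpre
      · exact hyy.trans hpre
    have hW : x ∉ W := by
      intro hx
      obtain ⟨l, r, rfl⟩ := List.append_of_mem hx
      obtain ⟨c, r', hr⟩ : ∃ c r', r ++ [x] = c :: r' := by
        cases r <;> simp
      have : [x, c] <:+: l ++ x :: r ++ [x] := ⟨l, r', by simp [hr]⟩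
      rcases AB.eq_or_eq hxy c with rfl | rfl
      · exact hxx this
      · exact hxy' this
    have hW' : W = List.replicate W.length y :=
      List.eq_replicate_iff.2 ⟨rfl, fun c hc =>
        (AB.eq_or_eq hxy c).resolve_left fun e => hW (e ▸ hc)⟩
    refine ⟨_, _, y, x, W.length, .base, hxy.symm, ?_⟩
    have : (List.replicate W.length [y]).flatten = W := by
      conv_rhs => rw [hW']
      generalize W.length = m
      induction m with
      | zero => rfl
      | succ m ih => simp [List.replicate_succ, ih]
    rw [this, hW']
    generalize W.length = m
    refine ⟨[y], ?_⟩
    calc [y] ++ (List.replicate m y ++ [x]) = List.replicate (m + 1) y ++ [x] := rfl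
      _ = _ := by simp [List.replicate_succ']
  · obtain ⟨w', hw'⟩ := exists_insertBefore_eq hxy
      fun h => hyy (h.trans (List.prefix_append W [x]).isInfix)
    have hlt : w'.length < n := by
      rcases hw' with hw' | ⟨hw', r, rfl⟩
      · have := length_le_length_insertBefore (x := x) w'
        simp [hw'] at this hn
        omega
      · have := length_lt_length_insertBefore hxy (w := w') (by simp [hw'])
        simp [hw'] at this hn
        omega
    have hext : RightExtendable w' := by
      refine RightExtendable.of_insertBefore hxy h ?_
      rcases hw' with hw' | ⟨hw', r, rfl⟩
      · exact Or.inl (by rw [hw'])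
      · exact Or.inr ⟨by simp [hw'], r ++ [x], rfl⟩
    have hsuf : W ++ [x] <:+ insertBefore x w' ++ [x] := by
      rcases hw' with hw' | ⟨hw', -⟩
      · rw [hw']
      · exact ⟨[x], by simp [hw']⟩
    obtain ⟨P, u, x', y', m, hP, hne, t, ht⟩ := ih _ hlt hext rfl
    refine ⟨_, _, x', y', m, hP.step x, hne, hsuf.trans ?_⟩
    rw [← StandardPair.insertBefore_eq x hne, ← ht]
    exact ⟨insertBefore x t, by simp⟩

/-- characterization of right special trapezoidal words. -/
theorem right_special_trapezoidal_characterization (w : Word) (htrap : IsTrapezoidal w) :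
    (IsTrapezoidal (w ++ [AB.a]) ∧ IsTrapezoidal (w ++ [AB.b])) ↔
      ((∃ c : Word, IsCentral c ∧ w <:+ c) ∨
       (∃ (p u : Word) (x y : AB), x ≠ y ∧ IsCentral u ∧
          w = p ++ [x] ++ u ++ [x] ++ [y] ++ u ∧
          minPeriod (p ++ [x] ++ u ++ [x]) = minPeriod (u ++ [x]))) := by
  simp only [isTrapezoidal_iff]
  constructor
  · rintro ⟨ha, hb⟩
    have hw : RightExtendable w := fun c => by cases c <;> assumption
    obtain ⟨P, u, x, y, n, hP, hxy, hs⟩ := hw.exists_standardPair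
    rcases le_or_gt w.length (u ++ [x, y] ++ u).length with hle | hlt
    · left
      have hs' := suffix_of_length_le hs (List.suffix_append _ _) hle
      refine ⟨_, ((hP.append y).append x).isCentral, hs'.trans ⟨P y, ?_⟩⟩
      rw [← hP.append_eq hxy]
      simp [insertBefore_cons_of_ne hxy.symm]
    · right
      obtain ⟨q, rfl⟩ := suffix_of_length_le (List.suffix_append _ _) hs hlt.le
      have hq : q <:+ (List.replicate n (P x)).flatten := by
        obtain ⟨t, ht⟩ := hs
        rw [← List.append_assoc] at ht
        exact ⟨t, List.append_cancel_right ht⟩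
      obtain ⟨p, rfl⟩ : ∃ p, q = p ++ [x] := by
        rcases List.eq_nil_or_concat q with rfl | ⟨p, c, rfl⟩
        · simp at hlt
        · rcases n with _ | n
          · simpa using hq.length_le
          · obtain ⟨l, hl⟩ := hP.exists_eq_append x
            rw [List.replicate_succ', List.flatten_append, List.flatten_singleton, hl,
              ← List.append_assoc, List.concat_eq_append] at hq
            obtain ⟨t, ht⟩ := hq
            rw [← List.append_assoc] at ht
            have := (List.append_inj' ht rfl).2
            exact ⟨p, by simp_all⟩
      refine ⟨p, u, x, y, hxy, hP.isCentral, by simp, ?_⟩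
      rw [hP.minPeriod_concat, ← hP.minPeriod_append_concat hq, List.append_assoc]
  · suffices h : _ → RightExtendable w from fun hw => ⟨h hw a, h hw b⟩
    rintro (⟨c, hc, hs⟩ | ⟨p, u, x, y, hxy, hu, rfl, hp⟩)
    · obtain ⟨P, hP⟩ := StandardPair.exists_of_isCentral hc
      exact (hP.rightExtendable (x := a) (y := b) (by simp) 0).of_suffix
        (hs.trans ⟨c ++ [a, b], by simp⟩)
    · obtain ⟨P, hP⟩ := StandardPair.exists_of_isCentral hu
      rw [hP.minPeriod_concat, List.append_assoc] at hp
      obtain ⟨n, t, ht⟩ := hP.exists_suffix_of_minPeriod hp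
      refine (hP.rightExtendable hxy n).of_suffix ⟨t, ?_⟩
      rw [← ht]
      simp
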